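/- Let d ≥ 1, L > 0, α, β ≥ 0, η > 0, let X ⊆ ℝ^d be nonempty with ℓ∞-diameter at most D, let h : X → ℝ be arbitrary and let f : X → ℝ be L-Lipschitz with respect to the ℓ1 norm. Let μ_η be the product probability measure on ℝ^d whose coordinates are i.i.d. exponential with parameter η. Suppose u, v : ℝ^d → X are measurable maps such that for μ_η-almost every σ, u(σ) is an (α,β)-approximate minimizer over X of z ↦ h(z) − ⟨σ, z⟩ and v(σ) is an (α,β)-approximate minimizer over X of z ↦ h(z) + f(z) − ⟨σ, z⟩. Then E_{σ∼μ_η}[ ‖u(σ) − v(σ)‖_1 ] ≤ 125 η L d² D + βd/(20ηL) + 2βd + α/(20L). -/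

import Mathlib

open MeasureTheory

noncomputable section

/-- The exponential distribution with rate `η`: density `η * exp (-η x)` on `[0, ∞)`,
so that `P (Z ≥ s) = exp (-η s)` for `s ≥ 0`. -/
def expoMeasure (η : ℝ) : Measure ℝ :=
  volume.withDensity fun x => ENNReal.ofReal (if 0 ≤ x then η * Real.exp (-(η * x)) else 0)

instance (η : ℝ) : SigmaFinite (expoMeasure η) := by
  unfold expoMeasure; infer_instance

/-- The product probability measure on `ℝ^d` whose coordinates are i.i.d. `Exp(η)`. -/
def expoProd (d : ℕ) (η : ℝ) : Measure (Fin d → ℝ) :=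
  Measure.pi fun _ => expoMeasure η

/-- Standard inner product on `ℝ^d`. -/
def dotp {d : ℕ} (σ x : Fin d → ℝ) : ℝ := ∑ i, σ i * x i

/-- ℓ1 norm on `ℝ^d`. -/
def l1 {d : ℕ} (x : Fin d → ℝ) : ℝ := ∑ i, |x i|

lemma expo_eq (η : ℝ) : expoMeasure η = ProbabilityTheory.expMeasure η := by
  unfold expoMeasure ProbabilityTheory.expMeasure ProbabilityTheory.gammaMeasure
  congr 1
  funext x
  rw [← ProbabilityTheory.exponentialPDF_eq]; rfl

lemma expo_prob {η : ℝ} (hη : 0 < η) : IsProbabilityMeasure (expoMeasure η) := by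
  rw [expo_eq]; exact ProbabilityTheory.isProbabilityMeasure_expMeasure hη

lemma dens_meas (η : ℝ) : Measurable
    (fun x : ℝ => ENNReal.ofReal (if 0 ≤ x then η * Real.exp (-(η * x)) else 0)) := by
  refine Measurable.ennreal_ofReal ?_
  exact Measurable.ite measurableSet_Ici (by fun_prop) (by fun_prop)

lemma expo_shift {η c : ℝ} (hc : 0 ≤ c) (s : Set ℝ) (hs : MeasurableSet s) :
    expoMeasure η (s ∩ Set.Ici c)
      = ENNReal.ofReal (Real.exp (-(η * c))) * expoMeasure η ((fun x => x + c) ⁻¹' s) := by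
  have hs' : MeasurableSet ((fun x : ℝ => x + c) ⁻¹' s) := (measurable_add_const c) hs
  unfold expoMeasure
  rw [withDensity_apply _ (hs.inter measurableSet_Ici), withDensity_apply _ hs',
    ← lintegral_indicator (hs.inter measurableSet_Ici), ← lintegral_indicator hs',
    ← lintegral_const_mul _ ((dens_meas η).indicator hs'),
    ← lintegral_add_right_eq_self _ c]
  congr 1
  funext x
  by_cases hx : x + c ∈ s
  · by_cases h0 : 0 ≤ x
    · have h1 : x + c ∈ s ∩ Set.Ici c := ⟨hx, by simpa using h0⟩
      have h2 : x ∈ ((fun x : ℝ => x + c) ⁻¹' s) := hx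
      rw [Set.indicator_of_mem h1, Set.indicator_of_mem h2, if_pos h0, if_pos (by linarith),
        ← ENNReal.ofReal_mul (Real.exp_pos _).le]
      congr 1
      rw [show -(η * (x + c)) = -(η * c) + -(η * x) by ring, Real.exp_add]; ring
    · have h1 : x + c ∉ s ∩ Set.Ici c := fun h => h0 (by simpa using h.2)
      have h2 : x ∈ ((fun x : ℝ => x + c) ⁻¹' s) := hx
      rw [Set.indicator_of_notMem h1, Set.indicator_of_mem h2, if_neg h0]; simp
  · have h1 : x + c ∉ s ∩ Set.Ici c := fun h => hx h.1
    have h2 : x ∉ ((fun x : ℝ => x + c) ⁻¹' s) := hx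
    rw [Set.indicator_of_notMem h1, Set.indicator_of_notMem h2]; simp

lemma prod_shift {d : ℕ} {η c : ℝ} (hc : 0 ≤ c) (i : Fin d) :
    ENNReal.ofReal (Real.exp (-(η * c))) •
      (expoProd d η).map (fun σ => σ + Pi.single i c) ≤ expoProd d η := by
  have hT : Measurable (fun σ : Fin d → ℝ => σ + Pi.single i c) := measurable_add_const _
  let S : Fin d → Set ℝ := fun j => if j = i then Set.Ici c else Set.univ
  have key : Measure.pi (fun j => (expoMeasure η).restrict (S j)) =
      ENNReal.ofReal (Real.exp (-(η * c))) •
      (expoProd d η).map (fun σ => σ + Pi.single i c) := by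
    refine Measure.pi_eq fun s hs => ?_
    rw [Measure.smul_apply, Measure.map_apply hT (MeasurableSet.univ_pi hs)]
    have : (fun σ : Fin d → ℝ => σ + Pi.single i c) ⁻¹' (Set.univ.pi s)
        = Set.univ.pi (fun j => (fun x => x + (Pi.single i c : Fin d → ℝ) j) ⁻¹' (s j)) := by
      ext σ; simp [Set.mem_pi]
    rw [this, expoProd, Measure.pi_pi, smul_eq_mul,
      ← Finset.mul_prod_erase _ _ (Finset.mem_univ i),
      ← Finset.mul_prod_erase _ (fun j => ((expoMeasure η).restrict (S j)) (s j))
        (Finset.mem_univ i), ← mul_assoc]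
    congr 1
    · rw [Measure.restrict_apply (hs i)]
      simp only [S, if_true, Pi.single_eq_same]
      rw [expo_shift hc _ (hs i)]
    · refine Finset.prod_congr rfl fun j hj => ?_
      have hj' : j ≠ i := Finset.ne_of_mem_erase hj
      simp [S, hj']
  rw [← key, ← Measure.restrict_pi_pi]
  exact Measure.restrict_le_self

lemma expo_nonneg (η : ℝ) : ∀ᵐ x ∂(expoMeasure η), 0 ≤ x := by
  unfold expoMeasure
  rw [ae_withDensity_iff (dens_meas η)]
  refine Filter.Eventually.of_forall fun x hx => ?_
  by_contra h
  simp [h] at hx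

lemma expo_mean {η : ℝ} (hη : 0 < η) :
    Integrable (fun x : ℝ => x) (expoMeasure η) ∧ ∫ x, x ∂(expoMeasure η) = 1 / η := by
  have h1 := Real.integral_rpow_mul_exp_neg_mul_Ioi (a := 2) (r := η) (by norm_num) hη
  have hG : Real.Gamma 2 = 1 := by
    exact Real.Gamma_two
  have e : ∀ x : ℝ, (ENNReal.ofReal (if 0 ≤ x then η * Real.exp (-(η * x)) else 0)).toReal • x
      = η * (Set.Ioi (0:ℝ)).indicator (fun t => t ^ ((2:ℝ) - 1) * Real.exp (-(η * t))) x := by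
    intro x
    rcases lt_trichotomy x 0 with hx | hx | hx
    · simp [not_le.mpr hx, not_lt.mpr hx.le]
    · simp [hx]
    · rw [if_pos hx.le, ENNReal.toReal_ofReal (by positivity), Set.indicator_of_mem (Set.mem_Ioi.2 hx),
        show (2:ℝ) - 1 = 1 by norm_num, Real.rpow_one, smul_eq_mul]; ring
  have hint : IntegrableOn (fun t => t ^ ((2:ℝ) - 1) * Real.exp (-(η * t))) (Set.Ioi (0:ℝ)) := by
    by_contra hn
    rw [integral_undef hn, hG] at h1
    have : 0 < (1/η) ^ (2:ℝ) * 1 := by positivity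
    linarith
  have hlt : ∀ᵐ x : ℝ, ENNReal.ofReal (if 0 ≤ x then η * Real.exp (-(η * x)) else 0) < ⊤ :=
    Filter.Eventually.of_forall fun x => ENNReal.ofReal_lt_top
  constructor
  · unfold expoMeasure
    rw [integrable_withDensity_iff_integrable_smul' (dens_meas η) hlt]
    simp_rw [e]
    exact ((integrable_indicator_iff measurableSet_Ioi).2 hint).const_mul _
  · unfold expoMeasure
    rw [integral_withDensity_eq_integral_toReal_smul (dens_meas η) hlt]
    simp_rw [e]
    rw [integral_const_mul, integral_indicator measurableSet_Ioi, h1, hG]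
    rw [show (2:ℝ) = ((2:ℕ):ℝ) by norm_num, Real.rpow_natCast]
    field_simp

lemma prod_prob {d : ℕ} {η : ℝ} (hη : 0 < η) : IsProbabilityMeasure (expoProd d η) := by
  have := expo_prob hη
  unfold expoProd; infer_instance

lemma prod_nonneg' {d : ℕ} {η : ℝ} (hη : 0 < η) : ∀ᵐ σ ∂(expoProd d η), ∀ i, 0 ≤ σ i := by
  have := expo_prob hη
  rw [ae_all_iff]
  intro i
  exact (measurePreserving_eval (fun _ : Fin d => expoMeasure η) i).quasiMeasurePreserving.ae
    (expo_nonneg η)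

lemma prod_l1 {d : ℕ} {η : ℝ} (hη : 0 < η) :
    Integrable (fun σ => l1 σ) (expoProd d η) ∧ ∫ σ, l1 σ ∂(expoProd d η) = d / η := by
  have := expo_prob hη
  have hi : ∀ i : Fin d, Integrable (fun σ : Fin d → ℝ => σ i) (expoProd d η) := fun i =>
    integrable_comp_eval (μ := fun _ : Fin d => expoMeasure η) (i := i) (f := fun x : ℝ => x) (expo_mean hη).1
  have hI : ∀ i : Fin d, ∫ σ : Fin d → ℝ, σ i ∂(expoProd d η) = 1 / η := fun i =>
    (integral_comp_eval (μ := fun _ : Fin d => expoMeasure η) (f := fun x : ℝ => x)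
      (by fun_prop)).trans (expo_mean hη).2
  have e : (fun σ : Fin d → ℝ => l1 σ) =ᵐ[expoProd d η] fun σ => ∑ i, σ i := by
    filter_upwards [prod_nonneg' hη] with σ hσ
    exact Finset.sum_congr rfl fun i _ => abs_of_nonneg (hσ i)
  constructor
  · exact (integrable_finsetSum _ fun i _ => hi i).congr e.symm
  · rw [integral_congr_ae e, integral_finsetSum _ fun i _ => hi i]
    simp [hI]; ring

lemma dotp_shift {d : ℕ} (σ x : Fin d → ℝ) (i : Fin d) (c : ℝ) :
    dotp (σ + Pi.single i c) x = dotp σ x + c * x i := by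
  simp [dotp, add_mul, Finset.sum_add_distrib, Pi.single_apply]

lemma l1_shift {d : ℕ} (σ : Fin d → ℝ) (i : Fin d) {c : ℝ} (hc : 0 ≤ c) (hσ : ∀ j, 0 ≤ σ j) :
    l1 (σ + Pi.single i c) = l1 σ + c := by
  have e : ∀ j, |(σ + Pi.single i c : Fin d → ℝ) j| = |σ j| + if j = i then c else 0 := by
    intro j
    by_cases hj : j = i
    · subst hj
      simp [abs_of_nonneg (hσ j), abs_of_nonneg (add_nonneg (hσ j) hc)]
    · simp [hj]
  simp only [l1, e, Finset.sum_add_distrib]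
  simp

lemma l1_symm {d : ℕ} (x y : Fin d → ℝ) : l1 (x - y) = l1 (y - x) := by
  simp [l1, abs_sub_comm]

/-- Deterministic monotonicity: after shifting coordinate `i` by `c`, the smaller of the new
coordinates is almost at least the larger of the old ones. -/
lemma det_mono {d : ℕ} {L α β c : ℝ} (hβ : 0 ≤ β) (hα : 0 ≤ α) (hL : 0 < L) (hc : 0 < c)
    (X : Set (Fin d → ℝ)) (h f : (Fin d → ℝ) → ℝ)
    (hf : ∀ x ∈ X, ∀ y ∈ X, |f x - f y| ≤ L * l1 (x - y))
    (σ u v u' v' : Fin d → ℝ) (i : Fin d) (hσ : ∀ j, 0 ≤ σ j)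
    (hu : u ∈ X ∧ ∀ z ∈ X, h u - dotp σ u ≤ h z - dotp σ z + (α + β * l1 σ))
    (hv : v ∈ X ∧ ∀ z ∈ X, h v + f v - dotp σ v ≤ h z + f z - dotp σ z + (α + β * l1 σ))
    (hu' : u' ∈ X ∧ ∀ z ∈ X, h u' - dotp (σ + Pi.single i c) u' ≤
      h z - dotp (σ + Pi.single i c) z + (α + β * l1 (σ + Pi.single i c)))
    (hv' : v' ∈ X ∧ ∀ z ∈ X, h v' + f v' - dotp (σ + Pi.single i c) v' ≤
      h z + f z - dotp (σ + Pi.single i c) z + (α + β * l1 (σ + Pi.single i c))) :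
    max (u i) (v i) - (L / c * l1 (u - v) + 3 / c * (α + β * l1 σ) + β)
      ≤ min (u' i) (v' i) := by
  have hl : 0 ≤ l1 (u - v) := Finset.sum_nonneg fun _ _ => abs_nonneg _
  have hs : 0 ≤ l1 σ := Finset.sum_nonneg fun _ _ => abs_nonneg _
  have hbs : 0 ≤ β * l1 σ := mul_nonneg hβ hs
  have hLl : 0 ≤ L * l1 (u - v) := mul_nonneg hL.le hl
  simp only [dotp_shift, l1_shift σ i hc.le hσ] at hu' hv'
  have hfl := abs_le.1 (hf u hu.1 v hv.1)
  have key : ∀ a b : ℝ, c * b - c * a ≤ L * l1 (u - v) + 3 * (α + β * l1 σ) + c * β →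
      b - (L / c * l1 (u - v) + 3 / c * (α + β * l1 σ) + β) ≤ a := by
    intro a b hab
    have : b - a ≤ (L * l1 (u - v) + 3 * (α + β * l1 σ) + c * β) / c := by
      rw [le_div_iff₀ hc]; linarith
    have e : (L * l1 (u - v) + 3 * (α + β * l1 σ) + c * β) / c =
      L / c * l1 (u - v) + 3 / c * (α + β * l1 σ) + β := by field_simp
    linarith
  have uu := hu.2 u' hu'.1
  have uu' := hu'.2 u hu.1
  have vv := hv.2 v' hv'.1
  have vv' := hv'.2 v hv.1
  have uv := hu.2 v hv.1
  have vu := hv.2 u hu.1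
  have uv' := hu'.2 v hv.1
  have vu' := hv'.2 u hu.1
  apply le_min
  · rcases max_choice (u i) (v i) with e | e <;> rw [e] <;> apply key <;> linarith
  · rcases max_choice (u i) (v i) with e | e <;> rw [e] <;> apply key <;> linarith

/-- Bound for one coordinate. -/
lemma coord_bound {d : ℕ} {η c D : ℝ} (hη : 0 < η) (hc : 0 ≤ c) (i : Fin d)
    (a b R : (Fin d → ℝ) → ℝ) (m : ℝ) (ha : Measurable a) (hb : Measurable b)
    (hR : Integrable R (expoProd d η)) (hR0 : ∀ᵐ σ ∂(expoProd d η), 0 ≤ R σ)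
    (hma : ∀ᵐ σ ∂(expoProd d η), m ≤ a σ ∧ a σ ≤ m + D)
    (hmb : ∀ᵐ σ ∂(expoProd d η), m ≤ b σ ∧ b σ ≤ m + D)
    (hD : 0 ≤ D)
    (hab : ∀ᵐ σ ∂(expoProd d η), a σ - R σ ≤ b (σ + Pi.single i c)) :
    ∫ σ, (a σ - b σ) ∂(expoProd d η) ≤ η * c * D + ∫ σ, R σ ∂(expoProd d η) := by
  have := prod_prob (d := d) hη
  set μ := expoProd d η with hμ
  set q := Real.exp (-(η * c)) with hq
  have q0 : 0 < q := Real.exp_pos _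
  have q1 : q ≤ 1 := Real.exp_le_one_iff.2 (by have := mul_nonneg hη.le hc; linarith)
  have q2 : 1 - η * c ≤ q := by have := Real.add_one_le_exp (-(η * c)); linarith
  have hT : Measurable (fun σ : Fin d → ℝ => σ + Pi.single i c) := measurable_add_const _
  have hle := prod_shift (η := η) hc i
  rw [← hμ, ← hq] at hle
  have iA : Integrable (fun σ => a σ - m) μ := by
    refine Integrable.of_bound (by fun_prop) D ?_
    filter_upwards [hma] with σ h
    rw [Real.norm_eq_abs, abs_le]; constructor <;> linarith
  have iB : Integrable (fun σ => b σ - m) μ := by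
    refine Integrable.of_bound (by fun_prop) D ?_
    filter_upwards [hmb] with σ h
    rw [Real.norm_eq_abs, abs_le]; constructor <;> linarith
  have hq' : ENNReal.ofReal q ≠ 0 := by simpa using q0
  have iBm : Integrable (fun σ => b σ - m) (μ.map (fun σ => σ + Pi.single i c)) := by
    have := iB.mono_measure hle
    rwa [integrable_smul_measure hq' ENNReal.ofReal_ne_top] at this
  have iBT : Integrable (fun σ => b (σ + Pi.single i c) - m) μ :=
    (integrable_map_measure iBm.1 hT.aemeasurable).1 iBm
  have s1 : q * ∫ σ, (b (σ + Pi.single i c) - m) ∂μ ≤ ∫ σ, (b σ - m) ∂μ := by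
    have := integral_mono_measure hle (f := fun σ => b σ - m)
      (by filter_upwards [hmb] with σ h; simp; linarith) iB
    rw [integral_smul_measure, integral_map hT.aemeasurable iBm.1,
      ENNReal.toReal_ofReal q0.le, smul_eq_mul] at this
    exact this
  have s2 : ∫ σ, (a σ - m) ∂μ - ∫ σ, R σ ∂μ ≤ ∫ σ, (b (σ + Pi.single i c) - m) ∂μ := by
    rw [← integral_sub iA hR]
    refine integral_mono_ae (iA.sub hR) iBT ?_
    filter_upwards [hab] with σ h
    linarith
  have s3 : ∫ σ, (a σ - m) ∂μ ≤ D := by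
    have := integral_mono_ae iA (integrable_const D)
      (by filter_upwards [hma] with σ h; linarith)
    simpa using this
  have s4 : 0 ≤ ∫ σ, R σ ∂μ := integral_nonneg_of_ae hR0
  have s5 : ∫ σ, (a σ - b σ) ∂μ = ∫ σ, (a σ - m) ∂μ - ∫ σ, (b σ - m) ∂μ := by
    rw [← integral_sub iA iB]; congr 1; funext σ; ring
  rw [s5]
  have s6 := mul_le_mul_of_nonneg_left s2 q0.le
  nlinarith [mul_nonneg (sub_nonneg.2 q1) s4, mul_nonneg (sub_nonneg.2 q1) (sub_nonneg.2 s3),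
    mul_nonneg (sub_nonneg.2 q2) hD]

/-- **Stability of consecutive FTPL predictions.** With `h = ∑_{i < t} f i` and `f = f t`,
`u σ` is the FTPL prediction `x_t(σ)` and `v σ` is `x_{t+1}(σ)`; both are
`(α,β)`-approximate minimizers of their respective perturbed cumulative losses. Then
`E‖u - v‖₁ ≤ 125 η L d² D + βd/(20ηL) + 2βd + α/(20L)`. -/
theorem ftpl_stability (d : ℕ) (hd : 1 ≤ d) (L α β η D : ℝ)
    (hL : 0 < L) (hα : 0 ≤ α) (hβ : 0 ≤ β) (hη : 0 < η)
    (X : Set (Fin d → ℝ)) (hX : X.Nonempty)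
    (hdiam : ∀ x ∈ X, ∀ y ∈ X, ∀ i, |x i - y i| ≤ D)
    (h f : (Fin d → ℝ) → ℝ)
    (hf : ∀ x ∈ X, ∀ y ∈ X, |f x - f y| ≤ L * l1 (x - y))
    (u v : (Fin d → ℝ) → (Fin d → ℝ))
    (humeas : Measurable u) (hvmeas : Measurable v)
    (huv : ∀ᵐ σ ∂(expoProd d η),
      (u σ ∈ X ∧ ∀ z ∈ X, h (u σ) - dotp σ (u σ) ≤ h z - dotp σ z + (α + β * l1 σ)) ∧
      (v σ ∈ X ∧ ∀ z ∈ X,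
        h (v σ) + f (v σ) - dotp σ (v σ) ≤ h z + f z - dotp σ z + (α + β * l1 σ))) :
    (∫ σ, l1 (u σ - v σ) ∂(expoProd d η)) ≤
      125 * η * L * d ^ 2 * D + β * d / (20 * η * L) + 2 * β * d + α / (20 * L) := by
  have hP := prod_prob (d := d) hη
  have hσ0 := prod_nonneg' (d := d) hη
  obtain ⟨il1, el1⟩ := prod_l1 (d := d) hη
  set μ := expoProd d η with hμ
  have hd0 : (0:ℝ) < d := by exact_mod_cast hd
  obtain ⟨x0, hx0⟩ := hX
  have hD : 0 ≤ D := le_trans (abs_nonneg _) (hdiam x0 hx0 x0 hx0 ⟨0, hd⟩)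
  set c : ℝ := 100 * L * d with hc
  have c0 : 0 < c := by positivity
  have iabs : ∀ i, Integrable (fun σ => |u σ i - v σ i|) μ := by
    intro i
    refine Integrable.of_bound (by fun_prop) D ?_
    filter_upwards [huv] with σ h
    rw [Real.norm_eq_abs, abs_abs]
    exact hdiam _ h.1.1 _ h.2.1 i
  have iS : Integrable (fun σ => l1 (u σ - v σ)) μ := by
    simp only [l1, Pi.sub_apply]
    exact integrable_finsetSum _ fun i _ => iabs i
  have eS : ∫ σ, l1 (u σ - v σ) ∂μ = ∑ i, ∫ σ, |u σ i - v σ i| ∂μ := by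
    simp only [l1, Pi.sub_apply]
    exact integral_finsetSum _ fun i _ => iabs i
  set S := ∫ σ, l1 (u σ - v σ) ∂μ with hS
  have iE : Integrable (fun σ => α + β * l1 σ) μ := (integrable_const α).add (il1.const_mul β)
  have eE : ∫ σ, (α + β * l1 σ) ∂μ = α + β * (d / η) := by
    rw [integral_add (integrable_const α) (il1.const_mul β), integral_const_mul, el1]; simp
  have iR : Integrable
      (fun σ => L / c * l1 (u σ - v σ) + 3 / c * (α + β * l1 σ) + β) μ :=
    ((iS.const_mul _).add (iE.const_mul _)).add (integrable_const β)
  have eR : ∫ σ, (L / c * l1 (u σ - v σ) + 3 / c * (α + β * l1 σ) + β) ∂μ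
      = L / c * S + 3 / c * (α + β * (d / η)) + β := by
    have i12 : Integrable (fun σ => L / c * l1 (u σ - v σ) + 3 / c * (α + β * l1 σ)) μ :=
      (iS.const_mul _).add (iE.const_mul _)
    rw [integral_add i12 (integrable_const β),
      integral_add (iS.const_mul _) (iE.const_mul _), integral_const_mul, integral_const_mul, eE]
    simp [hS]
  have hbound : ∀ i, ∫ σ, |u σ i - v σ i| ∂μ ≤
      η * c * D + (L / c * S + 3 / c * (α + β * (d / η)) + β) := by
    intro i
    have hbb : BddBelow ((fun x : Fin d → ℝ => x i) '' X) := by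
      refine ⟨x0 i - D, ?_⟩
      rintro _ ⟨x, hx, rfl⟩
      have := (abs_le.1 (hdiam x0 hx0 x hx i)).2
      simp only; linarith
    set m := sInf ((fun x : Fin d → ℝ => x i) '' X) with hm
    have m1 : ∀ x ∈ X, m ≤ x i := fun x hx => csInf_le hbb ⟨x, hx, rfl⟩
    have m2 : ∀ x ∈ X, x i ≤ m + D := by
      intro x hx
      have : x i - D ≤ m := by
        refine le_csInf ⟨_, x0, hx0, rfl⟩ ?_
        rintro _ ⟨y, hy, rfl⟩
        have := (abs_le.1 (hdiam x hx y hy i)).2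
        simp only; linarith
      linarith
    have hac : Measure.map (fun σ : Fin d → ℝ => σ + Pi.single i c) μ ≪ μ := by
      have hle := prod_shift (η := η) c0.le i
      rw [← hμ] at hle
      have hq' : ENNReal.ofReal (Real.exp (-(η * c))) ≠ 0 := by simpa using Real.exp_pos _
      refine Measure.AbsolutelyContinuous.trans ?_ (Measure.absolutelyContinuous_of_le hle)
      exact Measure.absolutelyContinuous_smul hq'
    have hT : Measurable (fun σ : Fin d → ℝ => σ + Pi.single i c) := measurable_add_const _
    have huv' := ae_of_ae_map hT.aemeasurable (hac.ae_le huv)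
    have cb := coord_bound (D := D) hη c0.le i (fun σ => max (u σ i) (v σ i))
      (fun σ => min (u σ i) (v σ i))
      (fun σ => L / c * l1 (u σ - v σ) + 3 / c * (α + β * l1 σ) + β) m
      (by fun_prop) (by fun_prop) iR ?_ ?_ ?_ hD ?_
    · rw [← hμ, eR] at cb
      simpa only [max_sub_min_eq_abs, abs_sub_comm] using cb
    · refine Filter.Eventually.of_forall fun σ => ?_
      have hl : 0 ≤ l1 (u σ - v σ) := Finset.sum_nonneg fun _ _ => abs_nonneg _
      have hs : 0 ≤ l1 σ := Finset.sum_nonneg fun _ _ => abs_nonneg _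
      positivity
    · filter_upwards [huv] with σ h
      exact ⟨le_max_of_le_left (m1 _ h.1.1), max_le (m2 _ h.1.1) (m2 _ h.2.1)⟩
    · filter_upwards [huv] with σ h
      exact ⟨le_min (m1 _ h.1.1) (m1 _ h.2.1), min_le_of_left_le (m2 _ h.1.1)⟩
    · filter_upwards [huv, huv', hσ0] with σ hh h' h0
      exact det_mono hβ hα hL c0 X h f hf σ _ _ _ _ i h0 hh.1 hh.2 h'.1 h'.2
  have hsum : S ≤ d * (η * c * D + (L / c * S + 3 / c * (α + β * (d / η)) + β)) := by
    refine eS.le.trans ((Finset.sum_le_sum fun i _ => hbound i).trans ?_)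
    rw [Finset.sum_const, Finset.card_univ, Fintype.card_fin, nsmul_eq_mul]
  have e1 : d * (η * c * D + (L / c * S + 3 / c * (α + β * (d / η)) + β))
      = 100 * (η * L * d ^ 2 * D) + S / 100 + 3 / 5 * (α / (20 * L))
        + 3 / 5 * (β * d / (20 * η * L)) + β * d := by
    rw [hc]; field_simp; ring
  rw [e1] at hsum
  have p1 : 0 ≤ η * L * d ^ 2 * D := by positivity
  have p2 : 0 ≤ α / (20 * L) := by positivity
  have p3 : 0 ≤ β * d / (20 * η * L) := by positivity
  have p4 : 0 ≤ β * d := by positivity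
  linarith
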